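/- Let φ : 𝔽₂ⁿ → 𝔽₂ be any Boolean function, and define φ′ : 𝔽₂ⁿ × 𝔽₂ → 𝔽₂ by φ′(x, b) = b·(1 + φ(x)) (so φ′(x,b) = 1 exactly when b = 1 and φ(x) = 0). Then gap(φ′) = 2·|{x ∈ 𝔽₂ⁿ : φ(x) = 1}|. In particular, φ has a satisfying assignment (some x with φ(x) = 1) if and only if φ′ is not balanced, i.e. gap(φ′) ≠ 0. -/

import Mathlib

/-- The gap of a Boolean function on a finite domain:
`gap h = ∑_y (−1)^{h(y)}`; `h` is balanced when `gap h = 0`. -/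
def gap {σ : Type*} [Fintype σ] (f : σ → ZMod 2) : ℤ :=
  ∑ y : σ, if f y = 0 then 1 else -1

theorem gap_mul_one_add {σ : Type*} [Fintype σ] (φ : σ → ZMod 2) :
    gap (fun p : σ × ZMod 2 => p.2 * (1 + φ p.1)) =
      2 * (Finset.univ.filter (fun x => φ x = 1)).card := by
  have fiber : ∀ a : ZMod 2,
      (∑ b : ZMod 2, if b * (1 + a) = 0 then (1 : ℤ) else -1) = 2 * if a = 1 then 1 else 0 := by
    decide
  simp only [gap, Fintype.sum_prod_type, fiber, ← Finset.mul_sum, Finset.sum_boole]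

/-- for `φ′(x,b) = b(1 + φ(x))`, we have
`gap(φ′) = 2 · #{x : φ(x) = 1}`; in particular `φ` is satisfiable iff `gap(φ′) ≠ 0`. -/
theorem stmt16 (n : ℕ) (φ : (Fin n → ZMod 2) → ZMod 2) :
    gap (fun p : (Fin n → ZMod 2) × ZMod 2 => p.2 * (1 + φ p.1)) =
      2 * (Finset.univ.filter (fun x : Fin n → ZMod 2 => φ x = 1)).card ∧
    ((∃ x, φ x = 1) ↔
      gap (fun p : (Fin n → ZMod 2) × ZMod 2 => p.2 * (1 + φ p.1)) ≠ 0) := by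
  refine ⟨gap_mul_one_add φ, ?_⟩
  rw [gap_mul_one_add]
  simp [Finset.filter_eq_empty_iff]
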